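/- arXiv:1904.06628 — 3 statements merged into one kernel-verified Lean document; each statement's English description precedes it below -/
import Mathlib

section
/- Assume μ - σ² > r. Suppose (b*, r_L*) is a local maximum of the Nash product N(b, r_L) with b* > 1, π(b*, r_L*) > π̄, and Γ(b*, r_L*) > Γ̄. Then the negotiated interest rate satisfies r_L* = r/2 + (μ² - r² - 2σ²(Γ̄ - π̄)) / (4(μ - σ² - r)). -/
/-- The gambler's asymptotic growth rate `Γ(b, r_L) = r_L + b(μ - r_L) - (σ²/2)b²`. -/
noncomputable def growthRate (μ σ : ℝ) (b rL : ℝ) : ℝ :=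
  rL + b * (μ - rL) - σ ^ 2 / 2 * b ^ 2

/-- The broker's profit rate `π(b, r_L) = (b - 1)(r_L - r)`. -/
noncomputable def profitRate (r : ℝ) (b rL : ℝ) : ℝ :=
  (b - 1) * (rL - r)

/-- The Nash product `N(b, r_L) = (π(b, r_L) - π̄)(Γ(b, r_L) - Γ̄)`. -/
noncomputable def nashProduct (μ σ r πbar Γbar : ℝ) (b rL : ℝ) : ℝ :=
  (profitRate r b rL - πbar) * (growthRate μ σ b rL - Γbar)

/-- The derivative of the Nash product in the margin rate. -/
theorem hasDerivAt_nashProduct_rate (μ σ r πbar Γbar b rL : ℝ) :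
    HasDerivAt (fun x => nashProduct μ σ r πbar Γbar b x)
      ((b - 1) * (growthRate μ σ b rL - Γbar) + (profitRate r b rL - πbar) * (1 - b)) rL := by
  have hπ : HasDerivAt (fun x => profitRate r b x - πbar) (b - 1) rL := by
    simpa [profitRate] using
      (((hasDerivAt_id rL).sub_const r).const_mul (b - 1)).sub_const πbar
  have hΓ : HasDerivAt (fun x => growthRate μ σ b x - Γbar) (1 - b) rL := by
    refine HasDerivAt.congr_deriv ((((hasDerivAt_id rL).add
      (((hasDerivAt_id rL).const_sub μ).const_mul b)).sub_const (σ ^ 2 / 2 * b ^ 2)).sub_const Γbar) ?_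
    ring
  exact hπ.mul hΓ

/-- The derivative of the Nash product in the bet fraction. -/
theorem hasDerivAt_nashProduct_bet (μ σ r πbar Γbar b rL : ℝ) :
    HasDerivAt (fun x => nashProduct μ σ r πbar Γbar x rL)
      ((rL - r) * (growthRate μ σ b rL - Γbar) +
        (profitRate r b rL - πbar) * (μ - rL - σ ^ 2 * b)) b := by
  have hπ : HasDerivAt (fun x => profitRate r x rL - πbar) (rL - r) b := by
    simpa [profitRate] using
      (((hasDerivAt_id b).sub_const 1).mul_const (rL - r)).sub_const πbar
  have hΓ : HasDerivAt (fun x => growthRate μ σ x rL - Γbar) (μ - rL - σ ^ 2 * b) b := by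
    refine HasDerivAt.congr_deriv (((((hasDerivAt_id b).mul_const (μ - rL)).const_add rL).sub
      ((hasDerivAt_pow 2 b).const_mul (σ ^ 2 / 2))).sub_const Γbar) ?_
    push_cast
    ring
  exact hπ.mul hΓ

/-- Assume `μ - σ² > r`. If `(b*, r_L*)` is a local maximum of the Nash product with
`b* > 1`, `π(b*, r_L*) > π̄`, and `Γ(b*, r_L*) > Γ̄`, then the negotiated interest rate is
`r_L* = r/2 + (μ² - r² - 2σ²(Γ̄ - π̄)) / (4(μ - σ² - r))`. -/
theorem stmt4 (μ σ r πbar Γbar : ℝ) (hσ : 0 < σ) (hfav : r < μ - σ ^ 2) (bstar rLstar : ℝ)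
    (hmax : IsLocalMax (fun p : ℝ × ℝ => nashProduct μ σ r πbar Γbar p.1 p.2) (bstar, rLstar))
    (hb : 1 < bstar) (hπ : πbar < profitRate r bstar rLstar)
    (hΓ : Γbar < growthRate μ σ bstar rLstar) :
    rLstar = r / 2 + (μ ^ 2 - r ^ 2 - 2 * σ ^ 2 * (Γbar - πbar)) / (4 * (μ - σ ^ 2 - r)) := by
  have hrate : IsLocalMax (fun x => nashProduct μ σ r πbar Γbar bstar x) rLstar :=
    hmax.comp_continuous (g := fun x : ℝ => (bstar, x)) (by fun_prop)
  have hbet : IsLocalMax (fun x => nashProduct μ σ r πbar Γbar x rLstar) bstar :=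
    hmax.comp_continuous (g := fun x : ℝ => (x, rLstar)) (by fun_prop)
  have hrate₀ := hrate.hasDerivAt_eq_zero (hasDerivAt_nashProduct_rate ..)
  have hbet₀ := hbet.hasDerivAt_eq_zero (hasDerivAt_nashProduct_bet ..)
  have hsurplus : growthRate μ σ bstar rLstar - Γbar = profitRate r bstar rLstar - πbar :=
    mul_left_cancel₀ (sub_ne_zero.2 hb.ne') (by linear_combination hrate₀)
  have hkelly : μ = σ ^ 2 * bstar + r := by
    rw [hsurplus] at hbet₀
    exact mul_left_cancel₀ (sub_ne_zero.2 hπ.ne') (by linear_combination hbet₀)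
  have hden : 4 * (μ - σ ^ 2 - r) ≠ 0 := by linarith
  simp only [growthRate, profitRate] at hsurplus
  subst hkelly
  rw [← sub_eq_iff_eq_add', eq_div_iff hden]
  linear_combination (-2 * σ ^ 2) * hsurplus
end

section
/- Assume μ - σ² > r and take the total non-cooperation threat point π̄ = 0, Γ̄ = μ - σ²/2. If (b*, r_L*) is a local maximum of the Nash product N with b* > 1, π(b*, r_L*) > 0, and Γ(b*, r_L*) > μ - σ²/2, then r_L* = (μ + 3r - σ²)/4 = (3/4)r + (1/4)(ν - σ²/2) where ν := μ - σ²/2, and the broker's profit rate equals π(b*, r_L*) = ((μ - σ² - r)/(2σ))². -/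
theorem hasDerivAt_nashProduct_left (μ σ r πbar Γbar b rL : ℝ) :
    HasDerivAt (fun x : ℝ => nashProduct μ σ r πbar Γbar x rL)
      ((rL - r) * (growthRate μ σ b rL - Γbar)
        + (profitRate r b rL - πbar) * (μ - rL - σ ^ 2 * b)) b := by
  have hπ : HasDerivAt (fun x : ℝ => profitRate r x rL - πbar) (1 * (rL - r)) b :=
    (((hasDerivAt_id b).sub_const 1).mul_const (rL - r)).sub_const πbar
  have hΓ : HasDerivAt (fun x : ℝ => growthRate μ σ x rL - Γbar)
      (1 * (μ - rL) - σ ^ 2 / 2 * (2 * b)) b :=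
    ((((hasDerivAt_id b).mul_const (μ - rL)).const_add rL).sub
      ((by simpa using hasDerivAt_pow 2 b : HasDerivAt (fun x : ℝ => x ^ 2) (2 * b) b).const_mul
        (σ ^ 2 / 2))).sub_const Γbar
  exact (hπ.mul hΓ).congr_deriv (by ring)

theorem hasDerivAt_nashProduct_right (μ σ r πbar Γbar b rL : ℝ) :
    HasDerivAt (fun y : ℝ => nashProduct μ σ r πbar Γbar b y)
      ((b - 1) * (growthRate μ σ b rL - Γbar)
        + (profitRate r b rL - πbar) * (1 - b)) rL := by
  have hπ : HasDerivAt (fun y : ℝ => profitRate r b y - πbar) ((b - 1) * 1) rL :=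
    (((hasDerivAt_id rL).sub_const r).const_mul (b - 1)).sub_const πbar
  have hΓ : HasDerivAt (fun y : ℝ => growthRate μ σ b y - Γbar) (1 + b * (-1)) rL :=
    (((hasDerivAt_id rL).add (((hasDerivAt_id rL).const_sub μ).const_mul b)).sub_const
      (σ ^ 2 / 2 * b ^ 2)).sub_const Γbar
  exact (hπ.mul hΓ).congr_deriv (by ring)

/-- Assume `μ - σ² > r` and take the total non-cooperation threat point `π̄ = 0`,
`Γ̄ = μ - σ²/2`. If `(b*, r_L*)` is a local maximum of the Nash product with `b* > 1`,
`π(b*, r_L*) > 0`, and `Γ(b*, r_L*) > μ - σ²/2`, then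
`r_L* = (μ + 3r - σ²)/4 = (3/4)r + (1/4)(ν - σ²/2)` where `ν := μ - σ²/2`, and the broker's
profit rate equals `((μ - σ² - r)/(2σ))²`. -/
theorem stmt5 (μ σ r : ℝ) (hσ : 0 < σ) (hfav : r < μ - σ ^ 2) (bstar rLstar : ℝ)
    (hmax : IsLocalMax
      (fun p : ℝ × ℝ => nashProduct μ σ r 0 (μ - σ ^ 2 / 2) p.1 p.2) (bstar, rLstar))
    (hb : 1 < bstar) (hπ : 0 < profitRate r bstar rLstar)
    (hΓ : μ - σ ^ 2 / 2 < growthRate μ σ bstar rLstar) :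
    rLstar = (μ + 3 * r - σ ^ 2) / 4 ∧
    rLstar = (3 / 4) * r + (1 / 4) * ((μ - σ ^ 2 / 2) - σ ^ 2 / 2) ∧
    profitRate r bstar rLstar = ((μ - σ ^ 2 - r) / (2 * σ)) ^ 2 := by
  have hcont_left : ContinuousAt (fun x : ℝ => (x, rLstar)) bstar := by fun_prop
  have hcont_right : ContinuousAt (fun y : ℝ => (bstar, y)) rLstar := by fun_prop
  have hmax_left : IsLocalMax
      (fun x : ℝ => nashProduct μ σ r 0 (μ - σ ^ 2 / 2) x rLstar) bstar :=
    hcont_left.eventually hmax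
  have hmax_right : IsLocalMax
      (fun y : ℝ => nashProduct μ σ r 0 (μ - σ ^ 2 / 2) bstar y) rLstar :=
    hcont_right.eventually hmax
  have hderiv_left := hmax_left.hasDerivAt_eq_zero
    (hasDerivAt_nashProduct_left μ σ r 0 (μ - σ ^ 2 / 2) bstar rLstar)
  have hderiv_right := hmax_right.hasDerivAt_eq_zero
    (hasDerivAt_nashProduct_right μ σ r 0 (μ - σ ^ 2 / 2) bstar rLstar)
  unfold profitRate at hπ
  simp only [profitRate, growthRate] at hderiv_left hderiv_right ⊢
  have hx : 0 < bstar - 1 := sub_pos.2 hb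
  have hy : 0 < rLstar - r := (mul_pos_iff_of_pos_left hx).1 hπ
  have hfoc_right : μ - σ ^ 2 - r - 2 * (rLstar - r) - σ ^ 2 / 2 * (bstar - 1) = 0 := by
    refine (mul_eq_zero.1 ?_).resolve_left (pow_pos hx 2).ne'
    linear_combination hderiv_right
  have hfoc_left : 2 * (μ - σ ^ 2 - r - (rLstar - r) - σ ^ 2 / 2 * (bstar - 1))
      - σ ^ 2 / 2 * (bstar - 1) = 0 := by
    refine (mul_eq_zero.1 ?_).resolve_left hπ.ne'
    linear_combination hderiv_left
  have hrate : rLstar - r = (μ - σ ^ 2 - r) / 4 := by linarith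
  have hfraction : bstar - 1 = (μ - σ ^ 2 - r) / σ ^ 2 := by
    rw [eq_div_iff (pow_pos hσ 2).ne']
    linarith
  refine ⟨by linarith, by linarith, ?_⟩
  rw [hrate, hfraction]
  field_simp
  norm_num
end

section
/- Suppose (b*, r_L*) is a local maximum of the Nash product N(b, r_L) with 𝟏ᵀb* > 1, π(b*, r_L*) > π̄, and Γ(b*, r_L*) > Γ̄. Then the final utilities are Γ(b*, r_L*) = (r + (Γ̄ - π̄))/2 + (1/4)(μ - r·𝟏)ᵀΣ⁻¹(μ - r·𝟏) and π(b*, r_L*) = (r - (Γ̄ - π̄))/2 + (1/4)(μ - r·𝟏)ᵀΣ⁻¹(μ - r·𝟏). -/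
open Matrix

/-- The gambler's asymptotic growth rate `Γ(b, r_L) = r_L + (μ - r_L·𝟏)ᵀb - (1/2)bᵀΣb`. -/
noncomputable def growthRateV {n : ℕ} (μ : Fin n → ℝ) (S : Matrix (Fin n) (Fin n) ℝ)
    (b : Fin n → ℝ) (rL : ℝ) : ℝ :=
  rL + (μ - rL • (1 : Fin n → ℝ)) ⬝ᵥ b - (1 / 2) * (b ⬝ᵥ (S *ᵥ b))

/-- The broker's profit rate `π(b, r_L) = (𝟏ᵀb - 1)(r_L - r)`. -/
noncomputable def profitRateV {n : ℕ} (r : ℝ) (b : Fin n → ℝ) (rL : ℝ) : ℝ :=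
  ((1 : Fin n → ℝ) ⬝ᵥ b - 1) * (rL - r)

/-- The Nash product `N(b, r_L) = (π(b, r_L) - π̄)(Γ(b, r_L) - Γ̄)`. -/
noncomputable def nashProductV {n : ℕ} (μ : Fin n → ℝ) (S : Matrix (Fin n) (Fin n) ℝ)
    (r πbar Γbar : ℝ) (b : Fin n → ℝ) (rL : ℝ) : ℝ :=
  (profitRateV r b rL - πbar) * (growthRateV μ S b rL - Γbar)

/-- First-order condition at a local maximum of an affine function times a quadratic one. -/
theorem mul_add_mul_eq_zero_of_isLocalMax {p₀ p₁ g₀ g₁ g₂ : ℝ}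
    (h : IsLocalMax (fun t : ℝ => (p₀ + t * p₁) * (g₀ + t * g₁ + t ^ 2 * g₂)) 0) :
    p₁ * g₀ + p₀ * g₁ = 0 := by
  have hp : HasDerivAt (fun t : ℝ => p₀ + t * p₁) p₁ 0 := by
    simpa using ((hasDerivAt_id (0 : ℝ)).mul_const p₁).const_add p₀
  have hg : HasDerivAt (fun t : ℝ => g₀ + t * g₁ + t ^ 2 * g₂) g₁ 0 := by
    simpa using (((hasDerivAt_id (0 : ℝ)).mul_const g₁).const_add g₀).fun_add
      ((hasDerivAt_pow 2 (0 : ℝ)).mul_const g₂)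
  simpa using h.hasDerivAt_eq_zero (hp.mul hg)

theorem growthRateV_add_profitRateV {n : ℕ} (μ : Fin n → ℝ) (S : Matrix (Fin n) (Fin n) ℝ)
    (r : ℝ) (b : Fin n → ℝ) (rL : ℝ) :
    growthRateV μ S b rL + profitRateV r b rL =
      r + (μ - r • (1 : Fin n → ℝ)) ⬝ᵥ b - (1 / 2) * (b ⬝ᵥ (S *ᵥ b)) := by
  simp only [growthRateV, profitRateV, sub_dotProduct, smul_dotProduct, smul_eq_mul]
  ring

theorem profitRateV_add_smul {n : ℕ} (r : ℝ) (b v : Fin n → ℝ) (rL t : ℝ) :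
    profitRateV r (b + t • v) rL =
      profitRateV r b rL + t * (((1 : Fin n → ℝ) ⬝ᵥ v) * (rL - r)) := by
  simp only [profitRateV, dotProduct_add, dotProduct_smul, smul_eq_mul]
  ring

theorem growthRateV_add_smul {n : ℕ} (μ : Fin n → ℝ) {S : Matrix (Fin n) (Fin n) ℝ}
    (hS : S.IsSymm) (b v : Fin n → ℝ) (rL t : ℝ) :
    growthRateV μ S (b + t • v) rL = growthRateV μ S b rL +
      t * ((μ - rL • (1 : Fin n → ℝ) - S *ᵥ b) ⬝ᵥ v) +
      t ^ 2 * (-(1 / 2) * (v ⬝ᵥ (S *ᵥ v))) := by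
  have hsymm : b ⬝ᵥ (S *ᵥ v) = (S *ᵥ b) ⬝ᵥ v := by
    rw [dotProduct_mulVec, ← mulVec_transpose, hS.eq]
  simp only [growthRateV, mulVec_add, mulVec_smul, dotProduct_add, add_dotProduct,
    dotProduct_smul, smul_dotProduct, sub_dotProduct, smul_eq_mul, hsymm,
    dotProduct_comm v (S *ᵥ b)]
  ring

/-- At a local maximum of the Nash product, the bargaining surpluses of both parties agree. -/
theorem surplus_eq_of_isLocalMax {n : ℕ} {μ : Fin n → ℝ} {S : Matrix (Fin n) (Fin n) ℝ}
    {r πbar Γbar : ℝ} {b : Fin n → ℝ} {rL : ℝ}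
    (hmax : IsLocalMax (fun p : (Fin n → ℝ) × ℝ =>
      nashProductV μ S r πbar Γbar p.1 p.2) (b, rL))
    (hb : (1 : Fin n → ℝ) ⬝ᵥ b ≠ 1) :
    growthRateV μ S b rL - Γbar = profitRateV r b rL - πbar := by
  have hmax' : IsLocalMax (fun p : (Fin n → ℝ) × ℝ =>
      nashProductV μ S r πbar Γbar p.1 p.2) ((fun t : ℝ => (b, rL + t)) 0) := by
    simpa using hmax
  have hcomp := hmax'.comp_continuous (g := fun t : ℝ => (b, rL + t)) (b := 0) (by fun_prop)
  have hfun : (fun p : (Fin n → ℝ) × ℝ => nashProductV μ S r πbar Γbar p.1 p.2) ∘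
      (fun t : ℝ => (b, rL + t)) = fun t : ℝ =>
        ((profitRateV r b rL - πbar) + t * ((1 : Fin n → ℝ) ⬝ᵥ b - 1)) *
        ((growthRateV μ S b rL - Γbar) + t * (1 - (1 : Fin n → ℝ) ⬝ᵥ b) + t ^ 2 * 0) := by
    funext t
    simp only [Function.comp_apply, nashProductV, profitRateV, growthRateV, sub_dotProduct,
      smul_dotProduct, smul_eq_mul]
    ring
  rw [hfun] at hcomp
  have hfoc := mul_add_mul_eq_zero_of_isLocalMax hcomp
  apply mul_left_cancel₀ (sub_ne_zero.mpr hb)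
  linarith

/-- At a local maximum of the Nash product with equal nonzero surpluses, the portfolio
satisfies the first-order condition of a gambler who borrows at the broker call rate. -/
theorem mulVec_eq_of_isLocalMax {n : ℕ} {μ : Fin n → ℝ} {S : Matrix (Fin n) (Fin n) ℝ}
    (hS : S.IsSymm) {r πbar Γbar : ℝ} {b : Fin n → ℝ} {rL : ℝ}
    (hmax : IsLocalMax (fun p : (Fin n → ℝ) × ℝ =>
      nashProductV μ S r πbar Γbar p.1 p.2) (b, rL))
    (heq : growthRateV μ S b rL - Γbar = profitRateV r b rL - πbar)
    (hπ : profitRateV r b rL - πbar ≠ 0) :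
    S *ᵥ b = μ - r • (1 : Fin n → ℝ) := by
  refine (sub_eq_zero.mp (dotProduct_eq_zero _ fun v => ?_)).symm
  have hmax' : IsLocalMax (fun p : (Fin n → ℝ) × ℝ =>
      nashProductV μ S r πbar Γbar p.1 p.2) ((fun t : ℝ => (b + t • v, rL)) 0) := by
    simpa using hmax
  have hcomp := hmax'.comp_continuous (g := fun t : ℝ => (b + t • v, rL)) (b := 0)
    (by fun_prop)
  have hfun : (fun p : (Fin n → ℝ) × ℝ => nashProductV μ S r πbar Γbar p.1 p.2) ∘
      (fun t : ℝ => (b + t • v, rL)) = fun t : ℝ =>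
        ((profitRateV r b rL - πbar) + t * (((1 : Fin n → ℝ) ⬝ᵥ v) * (rL - r))) *
        ((growthRateV μ S b rL - Γbar) +
          t * ((μ - rL • (1 : Fin n → ℝ) - S *ᵥ b) ⬝ᵥ v) +
          t ^ 2 * (-(1 / 2) * (v ⬝ᵥ (S *ᵥ v)))) := by
    funext t
    simp only [Function.comp_apply, nashProductV, profitRateV_add_smul,
      growthRateV_add_smul μ hS]
    ring
  rw [hfun] at hcomp
  have hfoc := mul_add_mul_eq_zero_of_isLocalMax hcomp
  rw [heq] at hfoc
  apply mul_left_cancel₀ hπ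
  simp only [sub_dotProduct, smul_dotProduct, smul_eq_mul] at hfoc ⊢
  linarith

/-- If `(b*, r_L*)` is a local maximum of the Nash product with `𝟏ᵀb* > 1`,
`π(b*, r_L*) > π̄`, and `Γ(b*, r_L*) > Γ̄`, then the final utilities are
`Γ* = (r + (Γ̄ - π̄))/2 + (1/4)(μ - r·𝟏)ᵀΣ⁻¹(μ - r·𝟏)` and
`π* = (r - (Γ̄ - π̄))/2 + (1/4)(μ - r·𝟏)ᵀΣ⁻¹(μ - r·𝟏)`. -/
theorem stmt14 {n : ℕ} (hn : 1 ≤ n) (μ : Fin n → ℝ) (S : Matrix (Fin n) (Fin n) ℝ)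
    (hS : S.PosDef) (r πbar Γbar : ℝ) (bstar : Fin n → ℝ) (rLstar : ℝ)
    (hmax : IsLocalMax (fun p : (Fin n → ℝ) × ℝ =>
      nashProductV μ S r πbar Γbar p.1 p.2) (bstar, rLstar))
    (hb : 1 < (1 : Fin n → ℝ) ⬝ᵥ bstar)
    (hπ : πbar < profitRateV r bstar rLstar)
    (hΓ : Γbar < growthRateV μ S bstar rLstar) :
    growthRateV μ S bstar rLstar = (r + (Γbar - πbar)) / 2 +
      (1 / 4) * ((μ - r • (1 : Fin n → ℝ)) ⬝ᵥ (S⁻¹ *ᵥ (μ - r • (1 : Fin n → ℝ)))) ∧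
    profitRateV r bstar rLstar = (r - (Γbar - πbar)) / 2 +
      (1 / 4) * ((μ - r • (1 : Fin n → ℝ)) ⬝ᵥ (S⁻¹ *ᵥ (μ - r • (1 : Fin n → ℝ)))) := by
  have heq := surplus_eq_of_isLocalMax hmax hb.ne'
  have hfoc := mulVec_eq_of_isLocalMax (isHermitian_iff_isSymm.mp hS.isHermitian) hmax heq
    (sub_pos.mpr hπ).ne'
  have hinv : S⁻¹ *ᵥ (μ - r • (1 : Fin n → ℝ)) = bstar := by
    rw [← hfoc, mulVec_mulVec, nonsing_inv_mul _ hS.det_pos.ne'.isUnit, one_mulVec]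
  have hsum := growthRateV_add_profitRateV μ S r bstar rLstar
  rw [hfoc, dotProduct_comm bstar] at hsum
  rw [hinv]
  constructor <;> linarith
end
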